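/- Let D be a dendrite such that every arc [a,b] ⊆ D with a ≠ b contains a free arc, i.e., there exist u,v ∈ [a,b] with u ≠ v such that (u,v) is an open subset of D. If f : D → D is a continuous topologically transitive map, then the hyperspace of ω-limit sets ω(f) is a totally disconnected subspace of 2^D. -/

import Mathlib

open TopologicalSpace Filter Topology

/-- The ω-limit set of a point `x` under a map `f`:
`ω(x,f) = ⋂ₙ cl { f^k(x) : k ≥ n }`. -/
def omegaLimitSet {X : Type*} [TopologicalSpace X] (f : X → X) (x : X) : Set X :=
  ⋂ n : ℕ, closure {y | ∃ k ≥ n, f^[k] x = y}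

/-- The hyperspace of ω-limit sets of `f`, as a subset of the hyperspace `2^X`. -/
def omegaHyperspace {X : Type*} [MetricSpace X] (f : X → X) :
    Set (NonemptyCompacts X) :=
  {A | ∃ x : X, (A : Set X) = omegaLimitSet f x}

/-- A map `f` is topologically transitive if for all nonempty open `U, V` there is
`n ∈ ℕ` (a positive integer) with `f^[n](U) ∩ V ≠ ∅`. -/
def TopTransitive {X : Type*} [TopologicalSpace X] (f : X → X) : Prop :=
  ∀ U V : Set X, IsOpen U → IsOpen V → U.Nonempty → V.Nonempty →
    ∃ n : ℕ, 0 < n ∧ ((f^[n] '' U) ∩ V).Nonempty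

section
variable {X : Type*} [MetricSpace X]

lemma exists_preconnected_of_dist_lt [CompactSpace X] [LocallyConnectedSpace X] {ε : ℝ}
    (hε : 0 < ε) : ∃ δ > 0, ∀ x y : X, dist x y < δ →
      ∃ C : Set X, IsPreconnected C ∧ x ∈ C ∧ y ∈ C ∧ ∀ z ∈ C, dist x z < ε := by
  obtain ⟨δ, hδ, h⟩ := lebesgue_number_lemma_of_metric (s := Set.univ)
    (c := fun x : X => connectedComponentIn (Metric.ball x (ε / 2)) x) isCompact_univ
    (fun x => Metric.isOpen_ball.connectedComponentIn)
    (fun x _ => Set.mem_iUnion.2 ⟨x, mem_connectedComponentIn (Metric.mem_ball_self (by linarith))⟩)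
  refine ⟨δ, hδ, fun x y hxy => ?_⟩
  obtain ⟨i, hi⟩ := h x trivial
  have hx := hi (Metric.mem_ball_self hδ)
  refine ⟨_, isPreconnected_connectedComponentIn, hx,
    hi (Metric.mem_ball.2 (by rwa [dist_comm])), fun z hz => ?_⟩
  have h1 := Metric.mem_ball.1 (connectedComponentIn_subset _ _ hx)
  have h2 := Metric.mem_ball.1 (connectedComponentIn_subset _ _ hz)
  linarith [dist_triangle_right x z i]

lemma IsPreconnected.exists_chain {C : Set X} (hC : IsPreconnected C) {δ : ℝ} (hδ : 0 < δ)
    {x y : X} (hx : x ∈ C) (hy : y ∈ C) :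
    ∃ (m : ℕ) (c : ℕ → X), c 0 = x ∧ (∀ j ≥ m, c j = y) ∧ (∀ j, c j ∈ C) ∧
      ∀ j, dist (c j) (c (j + 1)) < δ := by
  have key : Relation.ReflTransGen (fun a b => a ∈ C ∧ b ∈ C ∧ dist a b < δ) x y := by
    refine hC.induction₂ (Relation.ReflTransGen (fun a b => a ∈ C ∧ b ∈ C ∧ dist a b < δ))
      (fun a ha => ?_) (fun _ _ _ _ _ _ => Relation.ReflTransGen.trans)
      (fun a b _ _ h => ?_) hx hy
    · filter_upwards [self_mem_nhdsWithin, mem_nhdsWithin_of_mem_nhds (Metric.ball_mem_nhds a hδ)]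
        with b hb hab
      exact .single ⟨ha, hb, by rwa [dist_comm]⟩
    · have : Std.Symm (fun a b => a ∈ C ∧ b ∈ C ∧ dist a b < δ) :=
        ⟨fun u v h => ⟨h.2.1, h.1, by rw [dist_comm]; exact h.2.2⟩⟩
      exact Std.Symm.symm _ _ h
  induction key using Relation.ReflTransGen.head_induction_on with
  | refl => exact ⟨0, fun _ => y, rfl, fun _ _ => rfl, fun _ => hy, fun _ => by simpa⟩
  | @head a b h _ ih =>
    obtain ⟨m, c, h0, hm, hcC, hd⟩ := ih h.2.1
    refine ⟨m + 1, fun j => j.casesOn a c, rfl, ?_, ?_, ?_⟩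
    · rintro (_ | j) hj
      · omega
      · exact hm j (by omega)
    · rintro (_ | j)
      · exact h.1
      · exact hcC j
    · rintro (_ | j)
      · simpa [h0] using h.2.2
      · exact hd j

/-- A sequence of points starting at `a`, equal to `b` from the index `s.1` on, with all jumps
smaller than `δ`. -/
def IsSmallJumpSeq (a b : X) (δ : ℝ) (s : ℕ × (ℕ → X)) : Prop :=
  0 < s.1 ∧ s.2 0 = a ∧ (∀ i ≥ s.1, s.2 i = b) ∧ ∀ i, dist (s.2 i) (s.2 (i + 1)) < δ

lemma IsSmallJumpSeq.refine {a b : X} {δ δ' ε : ℝ} (hδ' : 0 < δ') (hε : 0 < ε)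
    (hδ : ∀ x y : X, dist x y < δ →
      ∃ C : Set X, IsPreconnected C ∧ x ∈ C ∧ y ∈ C ∧ ∀ z ∈ C, dist x z < ε)
    {s : ℕ × (ℕ → X)} (hs : IsSmallJumpSeq a b δ s) :
    ∃ s', IsSmallJumpSeq a b δ' s' ∧ ∃ k > 0, s'.1 = k * s.1 ∧
      ∀ i, dist (s.2 (i / k)) (s'.2 i) < ε := by
  obtain ⟨N, x⟩ := s
  obtain ⟨hN, h0, hb, hd⟩ := hs
  dsimp only at *
  have key : ∃ k > 0, ∀ i, ∃ c : ℕ → X, c 0 = x i ∧ (∀ j ≥ k, c j = x (i + 1)) ∧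
      (∀ j, dist (x i) (c j) < ε) ∧ (∀ j, dist (c j) (c (j + 1)) < δ') ∧
      (N ≤ i → ∀ j, c j = b) := by
    have : ∀ i, ∃ (m : ℕ) (c : ℕ → X), c 0 = x i ∧ (∀ j ≥ m, c j = x (i + 1)) ∧
      (∀ j, dist (x i) (c j) < ε) ∧ ∀ j, dist (c j) (c (j + 1)) < δ' := by
      intro i
      obtain ⟨C, hC, h1, h2, h3⟩ := hδ _ _ (hd i)
      obtain ⟨m, c, hc0, hcm, hcC, hcd⟩ := hC.exists_chain hδ' h1 h2
      exact ⟨m, c, hc0, hcm, fun j => h3 _ (hcC j), hcd⟩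
    choose m c hc using this
    refine ⟨(Finset.range N).sup m + 1, by omega, fun i => ?_⟩
    rcases lt_or_ge i N with hi | hi
    · have := Finset.le_sup (f := m) (Finset.mem_range.2 hi)
      exact ⟨c i, (hc i).1, fun j hj => (hc i).2.1 j (by omega), (hc i).2.2.1, (hc i).2.2.2,
        fun h => absurd h (by omega)⟩
    · exact ⟨fun _ => b, by rw [hb i hi], fun j _ => by rw [hb (i + 1) (by omega)],
        fun j => by rw [hb i hi]; simpa, fun j => by simpa,
        fun _ _ => rfl⟩
  obtain ⟨k, hk, h⟩ := key
  choose c hc0 hck hcε hcd hcb using h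
  refine ⟨(k * N, fun i => c (i / k) (i % k)), ⟨by positivity, ?_, ?_, ?_⟩, k, hk, rfl, ?_⟩
  · simp [hc0, h0]
  · intro i hi
    have hi' : N ≤ i / k := by
      rw [Nat.le_div_iff_mul_le hk, mul_comm]; exact hi
    exact hcb _ hi' _
  · intro i
    dsimp only
    rcases lt_or_ge (i % k + 1) k with h | h
    · obtain ⟨h1, h2⟩ : (i + 1) / k = i / k ∧ (i + 1) % k = i % k + 1 := by
        rw [Nat.div_mod_unique hk]
        exact ⟨by have := Nat.mod_add_div i k; omega, h⟩
      rw [h1, h2]; exact hcd _ _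
    · have hmod : i % k + 1 = k := le_antisymm (Nat.mod_lt i hk) h
      have h3 : i + 1 = k * (i / k + 1) := by
        have := Nat.div_add_mod i k
        nlinarith
      have h1 : (i + 1) / k = i / k + 1 := by rw [h3, Nat.mul_div_cancel_left _ hk]
      have h2 : (i + 1) % k = 0 := by rw [h3, Nat.mul_mod_right]
      rw [h1, h2, hc0, ← hck (i / k) k le_rfl]
      have := hcd (i / k) (i % k)
      rwa [hmod] at this
  · exact fun i => hcε _ _


lemma exists_path_of_locallyConnected [CompactSpace X] [LocallyConnectedSpace X] {ε : ℝ}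
    (hε : 0 < ε) : ∃ δ > 0, ∀ a b : X, dist a b < δ →
      ∃ γ : Path a b, ∀ t, dist a (γ t) ≤ ε := by
  have hpos : ∀ n : ℕ, 0 < ε / 2 / 2 ^ n := fun n => by positivity
  choose δ hδ hδC using fun n => exists_preconnected_of_dist_lt (X := X) (hpos n)
  refine ⟨δ 0, hδ 0, fun a b hab => ?_⟩
  have step : ∀ n s, IsSmallJumpSeq a b (δ n) s → ∃ s', IsSmallJumpSeq a b (δ (n + 1)) s' ∧ ∃ k > 0,
      s'.1 = k * s.1 ∧ ∀ i, dist (s.2 (i / k)) (s'.2 i) < ε / 2 / 2 ^ n :=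
    fun n s hs => hs.refine (hδ (n + 1)) (hpos n) (hδC n)
  choose! next hnext hlink using step
  let s : ℕ → ℕ × (ℕ → X) := fun n => Nat.rec (1, fun i => if i = 0 then a else b) next n
  have hs : ∀ n, IsSmallJumpSeq a b (δ n) (s n) := by
    intro n
    induction n with
    | zero =>
      refine ⟨one_pos, rfl, fun i hi => if_neg (Nat.pos_iff_ne_zero.1 hi), ?_⟩
      rintro (_ | i)
      · simpa [s] using hab
      · simpa [s] using hδ 0
    | succ n ih => exact hnext n _ ih
  let g : ℕ → ℝ → X := fun n t => (s n).2 ⌊t * (s n).1⌋₊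
  have hg : ∀ t n, dist (g n t) (g (n + 1) t) ≤ ε / 2 / 2 ^ n := by
    intro t n
    obtain ⟨k, hk, hN, hd⟩ := hlink n _ (hs n)
    have h1 : (s (n + 1)).1 = k * (s n).1 := hN
    have h2 : ⌊t * (s (n + 1)).1⌋₊ / k = ⌊t * (s n).1⌋₊ := by
      rw [← Nat.floor_div_natCast, h1]
      congr 1
      push_cast
      have : (k : ℝ) ≠ 0 := by positivity
      field_simp
    have := hd ⌊t * (s (n + 1)).1⌋₊
    rw [h2] at this
    exact this.le
  have hlim : ∀ t, ∃ x, Tendsto (fun n => g n t) atTop (𝓝 x) := fun t =>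
    cauchySeq_tendsto_of_complete (cauchySeq_of_le_geometric_two (hg t))
  choose G hG using hlim
  have hdist : ∀ t n, dist (g n t) (G t) ≤ ε / 2 ^ n := fun t n =>
    dist_le_of_le_geometric_two_of_tendsto (hg t) (hG t) n
  have hg0 : ∀ n, g n 0 = a := fun n => by simpa [g] using (hs n).2.1
  have hg1 : ∀ n, g n 1 = b := fun n => by simpa [g] using (hs n).2.2.1 _ le_rfl
  have hG0 : G 0 = a := tendsto_nhds_unique (hG 0) (by simp [hg0])
  have hG1 : G 1 = b := tendsto_nhds_unique (hG 1) (by simp [hg1])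
  have hjump : ∀ n i, dist ((s n).2 i) ((s n).2 (i + 1)) ≤ ε / 2 / 2 ^ n := fun n i => by
    obtain ⟨C, -, -, h2, h3⟩ := hδC n _ _ ((hs n).2.2.2 i)
    exact (h3 _ h2).le
  have hcont : Continuous fun t : unitInterval => G t := by
    rw [Metric.continuous_iff]
    intro t η hη
    obtain ⟨n, hn⟩ : ∃ n : ℕ, ε * 3 * (1 / 2) ^ n < η := by
      obtain ⟨n, hn⟩ := exists_pow_lt_of_lt_one (show 0 < η / (ε * 3) by positivity)
        (show (1 / 2 : ℝ) < 1 by norm_num)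
      exact ⟨n, by rwa [lt_div_iff₀' (by positivity)] at hn⟩
    have hN : (0 : ℝ) < (s n).1 := by exact_mod_cast (hs n).1
    have close : ∀ u v : unitInterval, (u : ℝ) ≤ v → (v - u : ℝ) < 1 / (s n).1 →
        dist (G u) (G v) < η := by
      intro u v huv hlt
      have h1 : ⌊(u : ℝ) * (s n).1⌋₊ ≤ ⌊(v : ℝ) * (s n).1⌋₊ :=
        Nat.floor_mono (by gcongr)
      have h2 : ⌊(v : ℝ) * (s n).1⌋₊ ≤ ⌊(u : ℝ) * (s n).1⌋₊ + 1 := by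
        rw [lt_div_iff₀ hN] at hlt
        have h3 : (v : ℝ) * (s n).1 ≤ u * (s n).1 + 1 := by linarith
        refine (Nat.floor_mono h3).trans_eq (Nat.floor_add_one ?_)
        exact mul_nonneg u.2.1 hN.le
      have h3 : dist (g n u) (g n v) ≤ ε / 2 / 2 ^ n := by
        rcases h1.eq_or_lt with h | h
        · simp only [g, h, dist_self]; exact (hpos n).le
        · have : ⌊(v : ℝ) * (s n).1⌋₊ = ⌊(u : ℝ) * (s n).1⌋₊ + 1 := by omega
          simp only [g, this]; exact hjump n _
      have h4 := hdist u n
      have h5 := hdist v n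
      rw [one_div_pow, ← div_eq_mul_one_div] at hn
      have h6 : ε / 2 / 2 ^ n = ε / 2 ^ n / 2 := by ring
      have h7 : ε * 3 / 2 ^ n = ε / 2 ^ n * 3 := by ring
      have h8 : 0 < ε / 2 ^ n := by positivity
      rw [dist_comm] at h4
      linarith [dist_triangle4 (G u) (g n u) (g n v) (G v)]
    refine ⟨1 / (s n).1, by positivity, fun u hu => ?_⟩
    rw [Subtype.dist_eq, Real.dist_eq, abs_lt] at hu
    rcases le_total (u : ℝ) t with h | h
    · exact close u t h (by linarith)
    · rw [dist_comm]; exact close t u h (by linarith)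
  refine ⟨⟨⟨fun t => G t, hcont⟩, hG0, hG1⟩, fun t => ?_⟩
  change dist a (G t) ≤ ε
  rcases t.2.2.lt_or_eq with h | h
  · have h1 : g 0 t = a := by
      have : ⌊(t : ℝ)⌋₊ = 0 := Nat.floor_eq_zero.2 h
      simp [g, s, this]
    simpa [h1] using hdist t 0
  · have : dist a b ≤ ε / 2 / 2 ^ 0 := hjump 0 0
    rw [pow_zero, div_one] at this
    rw [h, hG1]
    linarith

lemma locallyPathConnectedSpace_of_compact_locallyConnected [CompactSpace X]
    [LocallyConnectedSpace X] : LocallyPathConnectedSpace X := by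
  rw [locallyPathConnectedSpace_iff_pathComponentIn_mem_nhds]
  intro x u hu hxu
  obtain ⟨r, hr, hru⟩ := Metric.isOpen_iff.1 hu x hxu
  obtain ⟨δ, hδ, h⟩ := exists_path_of_locallyConnected (X := X) (half_pos hr)
  filter_upwards [Metric.ball_mem_nhds x hδ] with y hy
  obtain ⟨γ, hγ⟩ := h x y (by rwa [dist_comm])
  exact ⟨γ, fun t => hru (by rw [Metric.mem_ball, dist_comm]; linarith [hγ t])⟩

/-- Closed sets of parameters containing the endpoints such that `γ` takes the same value at both
ends of every complementary gap. -/
def gapSets (γ : C(unitInterval, X)) : Set (Set unitInterval) :=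
  {F | IsClosed F ∧ 0 ∈ F ∧ 1 ∈ F ∧
    ∀ u ∈ F, ∀ v ∈ F, u < v → (∀ w ∈ F, w ≤ u ∨ v ≤ w) → γ u = γ v}

lemma exists_minimal_gapSets (γ : C(unitInterval, X)) :
    ∃ F, Minimal (· ∈ gapSets γ) F := by
  refine zorn_superset _ fun c hc hchain => ?_
  rcases c.eq_empty_or_nonempty with rfl | hne
  · refine ⟨Set.univ, ⟨isClosed_univ, trivial, trivial, fun u _ v _ huv h => ?_⟩, by simp⟩
    obtain ⟨w, h1, h2⟩ := exists_between huv
    rcases h w trivial with h | h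
    · exact absurd h1 h.not_gt
    · exact absurd h2 h.not_gt
  refine ⟨⋂₀ c, ⟨isClosed_sInter fun F hF => (hc hF).1, fun F hF => (hc hF).2.1,
    fun F hF => (hc hF).2.2.1, fun u hu v hv huv hgap => ?_⟩, fun F hF => Set.sInter_subset_of_mem hF⟩
  by_contra hne'
  obtain ⟨A, B, hA, hB, huA, hvB, hAB⟩ := t2_separation hne'
  have hdisj : ∀ t, γ t ∈ A → γ t ∉ B := fun t h1 h2 => Set.disjoint_left.1 hAB h1 h2
  have hK : IsCompact (Set.Icc u v ∩ (γ ⁻¹' (A ∪ B))ᶜ) :=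
    (isClosed_Icc.inter ((hA.union hB).preimage γ.continuous).isClosed_compl).isCompact
  have : Nonempty c := hne.to_subtype
  have hempty : Set.Icc u v ∩ (γ ⁻¹' (A ∪ B))ᶜ ∩ ⋂ F : c, (F : Set unitInterval) = ∅ := by
    rw [Set.eq_empty_iff_forall_notMem]
    rintro w ⟨⟨⟨h1, h2⟩, h⟩, hw⟩
    rcases hgap w (fun F hF => Set.mem_iInter.1 hw ⟨F, hF⟩) with h' | h'
    · exact h (.inl (le_antisymm h' h1 ▸ huA))
    · exact h (.inr (le_antisymm h2 h' ▸ hvB))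
  obtain ⟨⟨F, hF⟩, hFK⟩ := hK.elim_directed_family_closed (fun F : c => (F : Set unitInterval))
    (fun F => (hc F.2).1) hempty (fun F G => (hchain.total F.2 G.2).elim
      (fun h => ⟨F, subset_rfl, h⟩) fun h => ⟨G, h, subset_rfl⟩)
  obtain ⟨hFc, -, -, hFgap⟩ := hc hF
  have hcov : ∀ w ∈ F, u ≤ w → w ≤ v → γ w ∈ A ∨ γ w ∈ B := by
    intro w hw h1 h2
    by_contra h
    exact (Set.eq_empty_iff_forall_notMem.1 hFK w) ⟨⟨⟨h1, h2⟩, h⟩, hw⟩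
  have huF : u ∈ F := hu F hF
  have hvF : v ∈ F := hv F hF
  obtain ⟨u', ⟨⟨hu'F, huu', hu'v⟩, hu'B⟩, hu'max⟩ :=
    ((hFc.inter (isClosed_Icc (a := u) (b := v))).inter
      (hB.preimage γ.continuous).isClosed_compl).isCompact.exists_isGreatest
        ⟨u, ⟨huF, le_rfl, huv.le⟩, hdisj u huA⟩
  have hu'A : γ u' ∈ A := (hcov u' hu'F huu' hu'v).resolve_right hu'B
  obtain ⟨v', ⟨⟨hv'F, huv', hv'v⟩, hv'A⟩, hv'min⟩ :=
    ((hFc.inter (isClosed_Icc (a := u') (b := v))).inter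
      (hA.preimage γ.continuous).isClosed_compl).isCompact.exists_isLeast
        ⟨v, ⟨hvF, hu'v, le_rfl⟩, fun h => hdisj v h hvB⟩
  have hv'B : γ v' ∈ B := (hcov v' hv'F (huu'.trans huv') hv'v).resolve_left hv'A
  have hlt : u' < v' := huv'.lt_of_ne fun h => hdisj u' hu'A (h ▸ hv'B)
  have heq := hFgap u' hu'F v' hv'F hlt fun w hw => by
    by_contra! hcon
    have hwv := hcon.2.le.trans hv'v
    rcases hcov w hw (huu'.trans hcon.1.le) hwv with h | h
    · exact hcon.1.not_ge (hu'max ⟨⟨hw, huu'.trans hcon.1.le, hwv⟩, hdisj w h⟩)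
    · exact hcon.2.not_ge (hv'min ⟨⟨hw, hcon.1.le, hwv⟩, fun h' => hdisj w h' h⟩)
  exact hdisj u' hu'A (heq ▸ hv'B)

lemma exists_path_ordConnected_fibers (γ : C(unitInterval, X)) :
    ∃ g : C(unitInterval, X), g 0 = γ 0 ∧ g 1 = γ 1 ∧ Set.range g ⊆ Set.range γ ∧
      ∀ s w t, s ≤ w → w ≤ t → g s = g t → g w = g s := by
  obtain ⟨F, ⟨hF, h0, h1, hgap⟩, hmin⟩ := exists_minimal_gapSets γ
  have hl : ∀ t, ∃ l, IsGreatest (F ∩ Set.Iic t) l := fun t =>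
    (hF.inter isClosed_Iic).isCompact.exists_isGreatest ⟨0, h0, t.2.1⟩
  have hr : ∀ t, ∃ r, IsLeast (F ∩ Set.Ici t) r := fun t =>
    (hF.inter isClosed_Ici).isCompact.exists_isLeast ⟨1, h1, t.2.2⟩
  choose l hl using hl
  choose r hr using hr
  have hlr : ∀ t, γ (l t) = γ (r t) := by
    intro t
    rcases ((Set.mem_Iic.1 (hl t).1.2).trans (Set.mem_Ici.1 (hr t).1.2)).eq_or_lt with h | h
    · rw [h]
    · refine hgap _ (hl t).1.1 _ (hr t).1.1 h fun w hw => ?_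
      rcases le_total w t with h | h
      · exact .inl ((hl t).2 ⟨hw, h⟩)
      · exact .inr ((hr t).2 ⟨hw, h⟩)
  have hstep : ∀ s t, s ≤ t → l s = l t ∨ (s ≤ r s ∧ r s ≤ l t ∧ l t ≤ t) := by
    intro s t hst
    rcases le_or_gt (l t) s with h | h
    · exact .inl (le_antisymm ((hl t).2 ⟨(hl s).1.1, (hl s).1.2.trans hst⟩)
        ((hl s).2 ⟨(hl t).1.1, h⟩))
    · exact .inr ⟨(hr s).1.2, (hr s).2 ⟨(hl t).1.1, h.le⟩, (hl t).1.2⟩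
  have hcont : Continuous fun t => γ (l t) := by
    have hu := CompactSpace.uniformContinuous_of_continuous γ.continuous
    refine UniformContinuous.continuous ?_
    rw [Metric.uniformContinuous_iff] at hu ⊢
    intro ε hε
    obtain ⟨δ, hδ, h⟩ := hu ε hε
    have key : ∀ s t : unitInterval, s ≤ t → dist s t < δ → dist (γ (l s)) (γ (l t)) < ε := by
      intro s t hst hd
      rcases hstep s t hst with h1 | ⟨h1, h2, h3⟩
      · simpa [h1]
      · rw [hlr s]
        refine h ?_
        rw [Subtype.dist_eq, Real.dist_eq, abs_lt] at hd ⊢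
        have h1' : (s : ℝ) ≤ r s := h1
        have h2' : (r s : ℝ) ≤ l t := h2
        have h3' : (l t : ℝ) ≤ t := h3
        constructor <;> linarith
    refine ⟨δ, hδ, fun {s t} hd => ?_⟩
    rcases le_total s t with h | h
    · exact key s t h hd
    · rw [dist_comm] at hd ⊢; exact key t s h hd
  refine ⟨⟨fun t => γ (l t), hcont⟩, ?_, ?_, ?_, ?_⟩
  · exact congrArg γ (le_antisymm (hl 0).1.2 (l 0).2.1)
  · exact congrArg γ (le_antisymm (l 1).2.2 ((hl 1).2 ⟨h1, Set.mem_Iic.2 le_rfl⟩))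
  · rintro _ ⟨t, rfl⟩
    exact ⟨l t, rfl⟩
  · intro s w t hsw hwt hst
    change γ (l s) = γ (l t) at hst
    change γ (l w) = γ (l s)
    rcases hstep s t (hsw.trans hwt) with h | ⟨ha, hb, hc⟩
    · have hs : l s ≤ l w := (hl w).2 ⟨(hl s).1.1, (hl s).1.2.trans hsw⟩
      have ht : l w ≤ l t := (hl t).2 ⟨(hl w).1.1, (hl w).1.2.trans hwt⟩
      rw [le_antisymm hs (h ▸ ht)]
    rcases hstep s w hsw with h | ⟨-, hd, -⟩
    · rw [h]
    have he : l w ≤ l t := (hl t).2 ⟨(hl w).1.1, (hl w).1.2.trans hwt⟩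
    have hrl : γ (r s) = γ (l t) := (hlr s).symm.trans hst
    have hmem : F ∩ (Set.Ioo (r s) (l t))ᶜ ∈ gapSets γ := by
      refine ⟨hF.inter isOpen_Ioo.isClosed_compl, ⟨h0, fun h => h.1.not_ge (r s).2.1⟩,
        ⟨h1, fun h => h.2.not_ge (l t).2.2⟩, fun u hu v hv huv hg => ?_⟩
      by_cases hx : ∃ x ∈ F, u < x ∧ x < v
      · obtain ⟨x, hxF, hux, hxv⟩ := hx
        have hxI : x ∈ Set.Ioo (r s) (l t) := by
          by_contra hxn
          rcases hg x ⟨hxF, hxn⟩ with h | h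
          · exact hux.not_ge h
          · exact hxv.not_ge h
        have hu' : u = r s := by
          apply le_antisymm
          · by_contra hlt
            exact hu.2 ⟨not_le.1 hlt, hux.trans hxI.2⟩
          · rcases hg (r s) ⟨(hr s).1.1, fun h => h.1.false⟩ with h | h
            · exact h
            · exact absurd (hxI.1.trans hxv) h.not_gt
        have hv' : v = l t := by
          apply le_antisymm
          · rcases hg (l t) ⟨(hl t).1.1, fun h => h.2.false⟩ with h | h
            · exact absurd (hux.trans hxI.2) h.not_gt
            · exact h
          · by_contra hlt
            exact hv.2 ⟨hxI.1.trans hxv, not_le.1 hlt⟩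
        rw [hu', hv', hrl]
      · push Not at hx
        exact hgap u hu.1 v hv.1 huv fun w hw => (le_or_gt w u).imp_right (hx w hw)
    have hsub := hmin hmem Set.inter_subset_left (hl w).1.1
    rcases hd.eq_or_lt with h | h
    · rw [← h, hlr s]
    rcases he.eq_or_lt with h' | h'
    · rw [h', hst]
    exact absurd ⟨h, h'⟩ hsub.2

lemma exists_monotone_reparametrization (g : C(unitInterval, X))
    (hg : ∀ s w t, s ≤ w → w ≤ t → g s = g t → g w = g s) :
    ∃ h : unitInterval → ℝ, Continuous h ∧ Monotone h ∧ ∀ s t, h s = h t ↔ g s = g t := by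
  set S : ℕ → Set X := fun n => g '' Set.Iic (denseSeq unitInterval n) with hS
  have hSc : ∀ n, IsCompact (S n) := fun n => isClosed_Iic.isCompact.image g.continuous
  have hSne : ∀ n, (S n).Nonempty := fun n => ⟨_, Set.mem_image_of_mem g (Set.mem_Iic.2 le_rfl)⟩
  let φ : ℕ → unitInterval → unitInterval → ℝ := fun n t u => Metric.infDist (g (t * u)) (S n)
  let m : ℕ → unitInterval → ℝ := fun n t => sSup (φ n t '' Set.univ)
  have hφc : ∀ n, Continuous ↿(φ n) := fun n =>
    (Metric.continuous_infDist_pt (S n)).comp (g.continuous.comp (continuous_fst.mul continuous_snd))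
  have hmc : ∀ n, Continuous (m n) := fun n => isCompact_univ.continuous_sSup (hφc n)
  have hle : ∀ n s t, s ≤ t → Metric.infDist (g s) (S n) ≤ m n t := by
    intro n s t hst
    refine le_csSup (isCompact_univ.image
      ((hφc n).comp (continuous_const.prodMk continuous_id))).bddAbove ?_
    refine ⟨⟨s / t, div_nonneg s.2.1 t.2.1, div_le_one_of_le₀ hst t.2.1⟩, trivial, ?_⟩
    change Metric.infDist (g _) (S n) = _
    congr 2
    ext
    rcases t.2.1.eq_or_lt with h | h
    · have hs : (s : ℝ) = 0 := le_antisymm (h ▸ hst) s.2.1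
      simp [← h, hs]
    · exact mul_div_cancel₀ _ h.ne'
  have hmle : ∀ n t c, (∀ s ≤ t, Metric.infDist (g s) (S n) ≤ c) → m n t ≤ c := by
    intro n t c h
    refine csSup_le (Set.univ_nonempty.image _) ?_
    rintro _ ⟨u, -, rfl⟩
    exact h _ (unitInterval.mul_le_left)
  have hm0 : ∀ n t, 0 ≤ m n t := fun n t => Metric.infDist_nonneg.trans (hle n t t le_rfl)
  have hmono : ∀ n, Monotone (m n) := fun n s t hst =>
    hmle n s _ fun w hw => hle n w t (hw.trans hst)
  have hbd : ∀ n t, m n t ≤ Metric.diam (Set.range g) := by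
    intro n t
    refine hmle n t _ fun s _ => ?_
    refine (Metric.infDist_le_dist_of_mem (y := g 0)
      (Set.mem_image_of_mem g (Set.mem_Iic.2 unitInterval.nonneg'))).trans ?_
    exact Metric.dist_le_diam_of_mem (isCompact_range g.continuous).isBounded ⟨s, rfl⟩ ⟨0, rfl⟩
  have hbd' : ∀ n t, ‖(1 / 2 : ℝ) ^ n * m n t‖ ≤ (1 / 2) ^ n * Metric.diam (Set.range g) := by
    intro n t
    rw [Real.norm_of_nonneg (mul_nonneg (by positivity) (hm0 n t))]
    exact mul_le_mul_of_nonneg_left (hbd n t) (by positivity)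
  have hsum : Summable fun n : ℕ => (1 / 2 : ℝ) ^ n * Metric.diam (Set.range g) :=
    summable_geometric_two.mul_right _
  have hsum' : ∀ t, Summable fun n : ℕ => (1 / 2 : ℝ) ^ n * m n t := fun t =>
    hsum.of_norm_bounded fun n => hbd' n t
  have hlt : ∀ s t, s ≤ t → g s ≠ g t →
      ∑' n, (1 / 2 : ℝ) ^ n * m n s < ∑' n, (1 / 2 : ℝ) ^ n * m n t := by
    intro s t hst hne
    have hst' : s < t := hst.lt_of_ne fun h => hne (by rw [h])
    obtain ⟨n, ⟨hn1, hn2⟩, hn3⟩ : ∃ n, denseSeq unitInterval n ∈ Set.Ioo s t ∩ {q | g q ≠ g t} := by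
      have hopen : IsOpen {q | g q ≠ g t} := isOpen_ne.preimage g.continuous
      have : (𝓝[>] s).NeBot := nhdsGT_neBot_of_exists_gt ⟨t, hst'⟩
      have hev : ∀ᶠ q in 𝓝[>] s, q ∈ Set.Ioo s t ∩ {q | g q ≠ g t} :=
        inter_mem (Ioo_mem_nhdsGT hst') (mem_nhdsWithin_of_mem_nhds (hopen.mem_nhds hne))
      exact (denseRange_denseSeq unitInterval).exists_mem_open (isOpen_Ioo.inter hopen) hev.exists
    refine Summable.tsum_lt_tsum (i := n)
      (fun k => mul_le_mul_of_nonneg_left (hmono k hst) (by positivity)) ?_ (hsum' s) (hsum' t)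
    refine mul_lt_mul_of_pos_left (lt_of_le_of_lt (hmle n s 0 fun w hw => ?_)
      (lt_of_lt_of_le ?_ (hle n t t le_rfl))) (by positivity)
    · exact (Metric.infDist_zero_of_mem (Set.mem_image_of_mem g (hw.trans hn1.le))).le
    · rw [← (hSc n).isClosed.notMem_iff_infDist_pos (hSne n)]
      rintro ⟨w, hw, hwt⟩
      exact hn3 ((hg w _ t hw hn2.le hwt).trans hwt)
  have heq : ∀ s t, s ≤ t → g s = g t → ∀ n, m n s = m n t := by
    intro s t hst h n
    refine le_antisymm (hmono n hst) (hmle n t _ fun w hw => ?_)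
    rcases le_total w s with h' | h'
    · exact hle n w s h'
    · rw [hg s w t h' hw h]; exact hle n s s le_rfl
  refine ⟨fun t => ∑' n, (1 / 2 : ℝ) ^ n * m n t, ?_, ?_, ?_⟩
  · exact continuous_tsum (fun n => continuous_const.mul (hmc n)) hsum hbd'
  · exact fun s t hst => (hsum' s).tsum_le_tsum
      (fun k => mul_le_mul_of_nonneg_left (hmono k hst) (by positivity)) (hsum' t)
  · intro s t
    constructor
    · intro h
      by_contra hne
      rcases le_total s t with hst | hst
      · exact (hlt s t hst hne).ne h
      · exact (hlt t s hst (Ne.symm hne)).ne h.symm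
    · intro h
      rcases le_total s t with hst | hst
      · simp only [heq s t hst h]
      · simp only [heq t s hst h.symm]

lemma exists_injective_of_ordConnected_fibers (g : C(unitInterval, X))
    (hg : ∀ s w t, s ≤ w → w ≤ t → g s = g t → g w = g s) (hne : g 0 ≠ g 1) :
    ∃ δ : C(unitInterval, X), Function.Injective δ ∧ δ 0 = g 0 ∧ δ 1 = g 1 ∧
      Set.range δ ⊆ Set.range g := by
  obtain ⟨h, hc, hm, hiff⟩ := exists_monotone_reparametrization g hg
  have h01 : 0 < h 1 - h 0 :=
    sub_pos.2 ((hm unitInterval.nonneg').lt_of_ne fun h' => hne ((hiff _ _).1 h'))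
  let H : unitInterval → unitInterval := fun t =>
    ⟨(h t - h 0) / (h 1 - h 0), div_nonneg (sub_nonneg.2 (hm unitInterval.nonneg')) h01.le,
      div_le_one_of_le₀ (sub_le_sub_right (hm unitInterval.le_one') _) h01.le⟩
  have hHc : Continuous H := ((hc.sub continuous_const).div_const _).subtype_mk _
  have hHiff : ∀ s t, H s = H t ↔ g s = g t := by
    intro s t
    rw [← hiff, Subtype.ext_iff]
    simp only [H, div_left_inj' h01.ne', sub_left_inj]
  have hH0 : H 0 = 0 := by ext; simp [H]
  have hH1 : H 1 = 1 := by ext; simp [H, div_self h01.ne']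
  have hsurj : Function.Surjective H := fun y =>
    mem_range_of_exists_le_of_exists_ge hHc ⟨0, by rw [hH0]; exact unitInterval.nonneg'⟩
      ⟨1, by rw [hH1]; exact unitInterval.le_one'⟩
  have hcomp : ∀ t, g (Function.surjInv hsurj (H t)) = g t := fun t =>
    (hHiff _ _).1 (Function.surjInv_eq hsurj _)
  refine ⟨⟨fun y => g (Function.surjInv hsurj y), ?_⟩, ?_, ?_, ?_, ?_⟩
  · rw [(hHc.isClosedMap.isQuotientMap hHc hsurj).continuous_iff]
    exact g.continuous.congr fun t => (hcomp t).symm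
  · intro x y hxy
    have := (hHiff _ _).2 hxy
    rwa [Function.surjInv_eq hsurj, Function.surjInv_eq hsurj] at this
  · simpa [hH0] using hcomp 0
  · simpa [hH1] using hcomp 1
  · rintro _ ⟨y, rfl⟩
    exact ⟨_, rfl⟩

lemma IsPathConnected.exists_injective_path {U : Set X} (hU : IsPathConnected U) {a b : X}
    (ha : a ∈ U) (hb : b ∈ U) (hab : a ≠ b) :
    ∃ δ : C(unitInterval, X), Function.Injective δ ∧ δ 0 = a ∧ δ 1 = b ∧ ∀ t, δ t ∈ U := by
  obtain ⟨γ, hγ⟩ := hU.joinedIn a ha b hb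
  obtain ⟨g, hg0, hg1, hgr, hg⟩ := exists_path_ordConnected_fibers (γ : C(unitInterval, X))
  have h0 : g 0 = a := hg0.trans γ.source
  have h1 : g 1 = b := hg1.trans γ.target
  obtain ⟨δ, hδ, hδ0, hδ1, hδr⟩ :=
    exists_injective_of_ordConnected_fibers g hg (by rwa [h0, h1])
  refine ⟨δ, hδ, hδ0.trans h0, hδ1.trans h1, fun t => ?_⟩
  obtain ⟨s, hs⟩ := hgr (hδr ⟨t, rfl⟩)
  exact hs ▸ hγ s

lemma exists_homeomorph_circle_of_arcs {α β : ℝ → X} {s t u v : ℝ} (hst : s < t) (huv : u < v)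
    (hα : Continuous α) (hβ : Continuous β) (hαi : Set.InjOn α (Set.Icc s t))
    (hβi : Set.InjOn β (Set.Icc u v)) (hs : α s = β u) (ht : α t = β v)
    (hdisj : ∀ x ∈ Set.Ioo u v, ∀ y ∈ Set.Icc s t, β x ≠ α y) :
    ∃ S : Set X, Nonempty (S ≃ₜ Circle) := by
  set p : ℝ := (t - s) + (v - u) with hp
  have hp0 : 0 < p := by linarith
  have : Fact (0 < p) := ⟨hp0⟩
  let c : ℝ → X := fun x => if x ≤ t then α x else β (v - (x - t))
  have hc : Continuous c := by
    refine Continuous.if_le hα (by fun_prop) continuous_id continuous_const fun x hx => ?_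
    rw [hx, ht]; simp
  have hclt : ∀ x, t < x → c x = β (v - (x - t)) := fun x hx => if_neg hx.not_ge
  have hcle : ∀ x, x ≤ t → c x = α x := fun x hx => if_pos hx
  have hper : c s = c (s + p) := by
    rw [hcle s hst.le, hclt _ (by linarith), hs]
    congr 1; linarith
  have hne : ∀ x y, x ∈ Set.Icc s t → t < y → y < s + p → c x ≠ c y := by
    intro x y hx hty hy
    rw [hcle x hx.2, hclt y hty]
    exact (hdisj _ ⟨by linarith, by linarith⟩ x hx).symm
  have hinj : Set.InjOn c (Set.Ico s (s + p)) := by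
    intro x hx y hy hxy
    rcases le_or_gt x t with hxt | hxt <;> rcases le_or_gt y t with hyt | hyt
    · rw [hcle x hxt, hcle y hyt] at hxy
      exact hαi ⟨hx.1, hxt⟩ ⟨hy.1, hyt⟩ hxy
    · exact absurd hxy (hne x y ⟨hx.1, hxt⟩ hyt hy.2)
    · exact absurd hxy.symm (hne y x ⟨hy.1, hyt⟩ hxt hx.2)
    · rw [hclt x hxt, hclt y hyt] at hxy
      have h1 := hx.2
      have h2 := hy.2
      have := hβi ⟨by linarith, by linarith⟩ ⟨by linarith, by linarith⟩ hxy
      linarith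
  have hLc : Continuous (AddCircle.liftIco p s c) :=
    AddCircle.liftIco_continuous hper hc.continuousOn
  have hLi : Function.Injective (AddCircle.liftIco p s c) := by
    intro x y hxy
    obtain ⟨x', hx', rfl⟩ : ∃ x' ∈ Set.Ico s (s + p), (x' : AddCircle p) = x :=
      ⟨_, (AddCircle.equivIco p s x).2, (AddCircle.equivIco p s).symm_apply_apply x⟩
    obtain ⟨y', hy', rfl⟩ : ∃ y' ∈ Set.Ico s (s + p), (y' : AddCircle p) = y :=
      ⟨_, (AddCircle.equivIco p s y).2, (AddCircle.equivIco p s).symm_apply_apply y⟩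
    rw [AddCircle.liftIco_coe_apply hx', AddCircle.liftIco_coe_apply hy'] at hxy
    rw [hinj hx' hy' hxy]
  exact ⟨_, ⟨(hLc.isClosedEmbedding hLi).isEmbedding.toHomeomorph.symm.trans
    (AddCircle.homeomorphCircle hp0.ne')⟩⟩

variable [CompactSpace X] [LocallyConnectedSpace X]

lemma notMem_connectedComponentIn_compl_singleton_of_arc
    (hX : ¬ ∃ S : Set X, Nonempty (S ≃ₜ Circle)) (γ : C(unitInterval, X))
    (hγ : Function.Injective γ) {r : unitInterval} (hr0 : 0 < r) (hr1 : r < 1) :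
    γ 0 ∉ connectedComponentIn {γ r}ᶜ (γ 1) := by
  intro hmem
  have hlpc : LocallyPathConnectedSpace X := locallyPathConnectedSpace_of_compact_locallyConnected
  have h1 : γ 1 ∈ ({γ r}ᶜ : Set X) := fun h => hr1.ne' (hγ h)
  have hpath : IsPathConnected (connectedComponentIn {γ r}ᶜ (γ 1)) :=
    isOpen_compl_singleton.connectedComponentIn.isConnected_iff_isPathConnected.1
      (isConnected_connectedComponentIn_iff.2 h1)
  obtain ⟨δ, hδ, hδ0, hδ1, hδm⟩ := hpath.exists_injective_path hmem
    (mem_connectedComponentIn h1) (hγ.ne zero_ne_one)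
  have hδr : ∀ t, δ t ≠ γ r := fun t => connectedComponentIn_subset _ _ (hδm t)
  have hA : IsClosed (δ ⁻¹' (γ '' Set.Iic r)) :=
    (isClosed_Iic.isCompact.image γ.continuous).isClosed.preimage δ.continuous
  have hB : IsClosed (δ ⁻¹' (γ '' Set.Ici r)) :=
    (isClosed_Ici.isCompact.image γ.continuous).isClosed.preimage δ.continuous
  obtain ⟨u, ⟨s, hsr, hsu⟩, humax⟩ := hA.isCompact.exists_isGreatest
    ⟨0, 0, hr0.le, hδ0.symm⟩
  obtain ⟨v, ⟨huv, t, hrt, htv⟩, hvmin⟩ := (isClosed_Ici.inter hB).isCompact.exists_isLeast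
    ⟨1, u.2.2, 1, hr1.le, hδ1.symm⟩
  have hst : s < t := by
    refine lt_of_le_of_ne (le_trans hsr hrt) fun h => hδr u ?_
    rw [← hsu, show s = r from le_antisymm hsr (h.symm ▸ Set.mem_Ici.1 hrt)]
  have huv' : u < v := by
    refine lt_of_le_of_ne huv fun h => hst.ne (hγ ?_)
    rw [hsu, htv, h]
  have hinj : ∀ (η : C(unitInterval, X)), Function.Injective η → ∀ x y : unitInterval,
      Set.InjOn (Set.IccExtend zero_le_one η) (Set.Icc (x : ℝ) y) := by
    intro η hη x y a ha b hb hab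
    have ha' : a ∈ Set.Icc (0 : ℝ) 1 := ⟨x.2.1.trans ha.1, ha.2.trans y.2.2⟩
    have hb' : b ∈ Set.Icc (0 : ℝ) 1 := ⟨x.2.1.trans hb.1, hb.2.trans y.2.2⟩
    rw [Set.IccExtend_of_mem _ _ ha', Set.IccExtend_of_mem _ _ hb'] at hab
    exact congrArg Subtype.val (hη hab)
  refine hX (exists_homeomorph_circle_of_arcs (α := Set.IccExtend zero_le_one γ)
    (β := Set.IccExtend zero_le_one δ) (s := s) (t := t) (u := u) (v := v) hst huv'
    γ.continuous.Icc_extend' δ.continuous.Icc_extend' (hinj γ hγ s t) (hinj δ hδ u v)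
    (by simp [hsu]) (by simp [htv]) fun x hx y _ hxy => ?_)
  have hx' : x ∈ Set.Icc (0 : ℝ) 1 := ⟨u.2.1.trans hx.1.le, hx.2.le.trans v.2.2⟩
  rw [Set.IccExtend_of_mem _ _ hx'] at hxy
  have hux : u < ⟨x, hx'⟩ := hx.1
  have hxv : (⟨x, hx'⟩ : unitInterval) < v := hx.2
  rcases le_total (Set.projIcc (0 : ℝ) 1 zero_le_one y) r with h | h
  · exact hux.not_ge (humax ⟨_, h, hxy.symm⟩)
  · exact hxv.not_ge (hvmin ⟨hux.le, _, h, hxy.symm⟩)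

/-- In a locally connected compact space without circles whose arcs contain free arcs, distinct
points are separated by a point of any given dense set. -/
lemma exists_isOpen_separating [ConnectedSpace X]
    (hX : ¬ ∃ S : Set X, Nonempty (S ≃ₜ Circle))
    (hfree : ∀ γ : C(unitInterval, X), Function.Injective γ →
      ∃ s t : unitInterval, s < t ∧ IsOpen (γ '' Set.Ioo s t))
    {T : Set X} (hT : Dense T) {a b : X} (hab : a ≠ b) :
    ∃ p ∈ T, ∃ V : Set X, IsOpen V ∧ b ∈ V ∧ IsClosed (V ∪ {p}) ∧ a ∉ V ∪ {p} := by
  have hlpc : LocallyPathConnectedSpace X := locallyPathConnectedSpace_of_compact_locallyConnected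
  have hpath : IsPathConnected (Set.univ : Set X) :=
    isOpen_univ.isConnected_iff_isPathConnected.1 isConnected_univ
  obtain ⟨γ, hγ, rfl, rfl, -⟩ := hpath.exists_injective_path (Set.mem_univ a) (Set.mem_univ b) hab
  obtain ⟨s, t, hst, ho⟩ := hfree γ hγ
  obtain ⟨_, ⟨r, hr, rfl⟩, hrT⟩ := hT.inter_open_nonempty _ ho ((Set.nonempty_Ioo.2 hst).image γ)
  have hr0 : 0 < r := lt_of_le_of_lt s.2.1 hr.1
  have hr1 : r < 1 := lt_of_lt_of_le hr.2 t.2.2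
  have h1 : γ 1 ∈ ({γ r}ᶜ : Set X) := fun h => hr1.ne' (hγ h)
  refine ⟨γ r, hrT, connectedComponentIn {γ r}ᶜ (γ 1),
    isOpen_compl_singleton.connectedComponentIn, mem_connectedComponentIn h1, ?_, ?_⟩
  · rw [← isOpen_compl_iff, isOpen_iff_mem_nhds]
    intro z hz
    have hzr : z ∈ ({γ r}ᶜ : Set X) := fun h => hz (.inr h)
    refine mem_of_superset (isOpen_compl_singleton.connectedComponentIn.mem_nhds
      (mem_connectedComponentIn hzr)) fun w hw hw' => ?_
    rcases hw' with hw' | hw'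
    · refine hz (.inl ?_)
      rw [connectedComponentIn_eq hw', ← connectedComponentIn_eq hw]
      exact mem_connectedComponentIn hzr
    · exact connectedComponentIn_subset _ _ hw hw'
  · rintro (h | h)
    · exact notMem_connectedComponentIn_compl_singleton_of_arc hX γ hγ hr0 hr1 h
    · exact hr0.ne (hγ h)

end

section
variable {X : Type*} [TopologicalSpace X] {f : X → X}

lemma isClosed_omegaLimitSet (f : X → X) (x : X) : IsClosed (omegaLimitSet f x) :=
  isClosed_iInter fun _ => isClosed_closure

lemma mapsTo_omegaLimitSet (hf : Continuous f) (x : X) :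
    Set.MapsTo f (omegaLimitSet f x) (omegaLimitSet f x) := by
  intro y hy
  refine Set.mem_iInter.2 fun n => ?_
  refine closure_mono ?_ (image_closure_subset_closure_image hf
    (Set.mem_image_of_mem f (Set.mem_iInter.1 hy n)))
  rintro _ ⟨_, ⟨k, hk, rfl⟩, rfl⟩
  exact ⟨k + 1, by omega, Function.iterate_succ_apply' f k x⟩

lemma omegaLimitSet_eq_univ_of_mem (hf : Continuous f) {x p : X}
    (hp : Dense (Set.range fun n => f^[n] p)) (hpx : p ∈ omegaLimitSet f x) :
    omegaLimitSet f x = Set.univ := by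
  refine Set.eq_univ_of_univ_subset (hp.closure_eq ▸ closure_minimal ?_ (isClosed_omegaLimitSet f x))
  rintro _ ⟨n, rfl⟩
  exact (mapsTo_omegaLimitSet hf x).iterate n hpx

lemma TopTransitive.dense_setOf_dense_orbit [BaireSpace X] [SecondCountableTopology X]
    (hf : Continuous f) (h : TopTransitive f) :
    Dense {p | Dense (Set.range fun n => f^[n] p)} := by
  have hB := isBasis_countableBasis X
  have key : Dense (⋂ V : countableBasis X, ⋃ n : ℕ, f^[n] ⁻¹' (V : Set X)) := by
    refine dense_iInter_of_isOpen
      (fun V => isOpen_iUnion fun n => (hB.isOpen V.2).preimage (hf.iterate n)) fun V => ?_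
    rw [dense_iff_inter_open]
    intro U hU hne
    obtain ⟨n, -, _, ⟨x, hx, rfl⟩, hxV⟩ :=
      h U V hU (hB.isOpen V.2) hne (nonempty_of_mem_countableBasis V.2)
    exact ⟨x, hx, Set.mem_iUnion.2 ⟨n, hxV⟩⟩
  refine key.mono fun p hp => ?_
  rw [Set.mem_ofPred_eq, hB.dense_iff]
  intro V hV _
  obtain ⟨n, hn⟩ := Set.mem_iUnion.1 (Set.mem_iInter.1 hp ⟨V, hV⟩)
  exact ⟨_, hn, n, rfl⟩

end

lemma exists_isClopen_separating_omegaHyperspace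
    {D : Type*} [MetricSpace D] [CompactSpace D] [ConnectedSpace D] [LocallyConnectedSpace D]
    (hD : ¬ ∃ S : Set D, Nonempty (S ≃ₜ Circle))
    (hfree : ∀ γ : C(unitInterval, D), Function.Injective γ →
      ∃ s t : unitInterval, s < t ∧ IsOpen (γ '' Set.Ioo s t))
    {f : D → D} (hf : Continuous f) (htrans : TopTransitive f) {A B : NonemptyCompacts D}
    {a : D} (haA : a ∈ A) (haB : a ∉ B) :
    ∃ u v : Set (NonemptyCompacts D), IsOpen u ∧ IsOpen v ∧ A ∈ u ∧ B ∈ v ∧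
      omegaHyperspace f ⊆ u ∪ v ∧ Disjoint u v := by
  have hT := htrans.dense_setOf_dense_orbit hf
  have hsep : ∀ b : (B : Set D), a ≠ b := fun b h => haB (h ▸ b.2)
  choose p hpT V hVo hbV hVc haV using fun b => exists_isOpen_separating hD hfree hT (hsep b)
  obtain ⟨I, hI⟩ := B.isCompact.elim_finite_subcover V hVo
    fun b hb => Set.mem_iUnion.2 ⟨⟨b, hb⟩, hbV ⟨b, hb⟩⟩
  have hcl : IsClosed (⋃ b ∈ I, (V b ∪ {p b})) := isClosed_biUnion_finset fun b _ => hVc b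
  refine ⟨{C | (C : Set D) ⊆ ⋃ b ∈ I, (V b ∪ {p b})}ᶜ, {C | (C : Set D) ⊆ ⋃ b ∈ I, V b},
    (NonemptyCompacts.isClosed_subsets_of_isClosed hcl).isOpen_compl,
    NonemptyCompacts.isOpen_subsets_of_isOpen (isOpen_biUnion fun b _ => hVo b),
    fun h => ?_, hI, fun C hC => ?_, ?_⟩
  · obtain ⟨b, -, hb⟩ := Set.mem_iUnion₂.1 (h haA)
    exact haV b hb
  · by_cases hCV : (C : Set D) ⊆ ⋃ b ∈ I, (V b ∪ {p b})
    · refine .inr fun z hz => ?_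
      obtain ⟨b, hbI, hb | hb⟩ := Set.mem_iUnion₂.1 (hCV hz)
      · exact Set.mem_iUnion₂.2 ⟨b, hbI, hb⟩
      obtain ⟨x, hx⟩ := hC
      rw [Set.mem_singleton_iff] at hb
      have huniv : (C : Set D) = Set.univ :=
        hx.trans (omegaLimitSet_eq_univ_of_mem hf (hpT b) (hx ▸ hb ▸ hz))
      obtain ⟨b', -, hb'⟩ := Set.mem_iUnion₂.1 (hCV (huniv ▸ Set.mem_univ a))
      exact absurd hb' (haV b')
    · exact .inl hCV
  · exact Set.disjoint_compl_left_iff_subset.2 fun C hC =>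
      hC.trans (Set.iUnion₂_mono fun b _ => Set.subset_union_left)

/-- Let `D` be a dendrite (a nontrivial compact connected locally connected metric
space containing no subset homeomorphic to the circle) such that every arc in `D`
(the image of an injective continuous `γ : [0,1] → D`) contains a free arc, i.e.
there are `u = γ s ≠ v = γ t` in the arc with the open subarc `(u,v) = γ '' (s,t)`
open in `D`.  If `f : D → D` is a continuous topologically transitive map, then
`ω(f)` is a totally disconnected subspace of `2^D`. -/
theorem omegaHyperspace_totallyDisconnected_of_freeArcs
    {D : Type*} [MetricSpace D] [CompactSpace D] [ConnectedSpace D]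
    [LocallyConnectedSpace D] [Nontrivial D]
    (hD : ¬ ∃ S : Set D, Nonempty (S ≃ₜ Circle))
    (hfree : ∀ γ : C(unitInterval, D), Function.Injective γ →
      ∃ s t : unitInterval, s < t ∧ IsOpen (γ '' Set.Ioo s t))
    (f : D → D) (hf : Continuous f) (htrans : TopTransitive f) :
    IsTotallyDisconnected (omegaHyperspace f) := by
  refine isTotallyDisconnected_of_isTotallySeparated fun A _ B _ hAB => ?_
  have hne : (A : Set D) ≠ B := fun h => hAB (SetLike.coe_injective h)
  by_cases hsub : (A : Set D) ⊆ B
  · obtain ⟨a, haB, haA⟩ := Set.not_subset.1 fun h => hne (hsub.antisymm h)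
    obtain ⟨u, v, hu, hv, hBu, hAv, hcov, hdisj⟩ :=
      exists_isClopen_separating_omegaHyperspace hD hfree hf htrans haB haA
    exact ⟨v, u, hv, hu, hAv, hBu, Set.union_comm u v ▸ hcov, hdisj.symm⟩
  · obtain ⟨a, haA, haB⟩ := Set.not_subset.1 hsub
    exact exists_isClopen_separating_omegaHyperspace hD hfree hf htrans haA haB
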